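/- arXiv:1903.05367 — 3 statements merged into one kernel-verified Lean document; each statement's English description precedes it below -/
import Mathlib

section
/- Let R, n, k, a be real numbers with 0 ≤ R² < 1, n > 0, a + n/2 > 0, n − k + 2a ≥ 0 and k + 1 > 0. Then ∫₀^∞ g^{−3/2} · exp(−n/(2g)) · (g + 1)^{n/2 − k/2 + a} · [1 + g(1 − R²)]^{−a − n/2} dg ≥ (1 − R²)^{−a − n/2} · Γ((k+1)/2) · [n/2 + (a + n/2)·(1 − R²)^{−1}]^{−(k+1)/2}. -/
open MeasureTheory Real

lemma aux_integrable (q n r s c : ℝ) (hq : -1 < q) (hn : 0 < n) (hr : 0 ≤ r) (hs : 0 < s)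
    (hc : 0 < c) :
    IntegrableOn (fun x : ℝ => x ^ q * Real.exp (-(n / 2) * x) * (1 + x) ^ r * (x + c) ^ (-s))
      (Set.Ioi 0) := by
  set d := n / (4 * (r + 1)) with hd
  have hd0 : 0 < d := by positivity
  set m := min 1 d with hm
  have hm0 : 0 < m := lt_min one_pos hd0
  have hdr : d * r ≤ n / 4 := by
    rw [hd, div_mul_eq_mul_div, div_le_div_iff₀ (by positivity) (by norm_num)]
    nlinarith
  have hI := (integrableOn_rpow_mul_exp_neg_mul_rpow (p := 1) (b := n / 4) hq one_pos
    (by positivity)).const_mul (m⁻¹ ^ r * c ^ (-s))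
  refine Integrable.mono' hI ?_ ?_
  · exact Measurable.aestronglyMeasurable (by fun_prop)
  · refine (ae_restrict_iff' measurableSet_Ioi).2 (Filter.Eventually.of_forall fun x hx => ?_)
    have hx : 0 < x := hx
    rw [Real.norm_of_nonneg (by positivity), rpow_one]
    have e1 : (x + c) ^ (-s) ≤ c ^ (-s) :=
      rpow_le_rpow_of_nonpos hc (by linarith) (by linarith)
    have e2 : 1 + x ≤ m⁻¹ * Real.exp (d * x) := by
      rw [inv_mul_eq_div, le_div_iff₀ hm0]
      have := Real.add_one_le_exp (d * x)
      have h1 : m ≤ 1 := min_le_left _ _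
      have h2 : m ≤ d := min_le_right _ _
      nlinarith
    have e3 : (1 + x) ^ r ≤ m⁻¹ ^ r * Real.exp (n / 4 * x) := by
      refine (rpow_le_rpow (by positivity) e2 hr).trans ?_
      rw [mul_rpow (by positivity) (by positivity), ← Real.exp_mul]
      have e5 : d * x * r ≤ n / 4 * x := by nlinarith
      exact mul_le_mul_of_nonneg_left (Real.exp_le_exp.2 e5) (by positivity)
    have e4 : Real.exp (-(n / 4) * x) = Real.exp (-(n / 2) * x) * Real.exp (n / 4 * x) := by
      rw [← Real.exp_add]; congr 1; ring
    calc _ ≤ x ^ q * Real.exp (-(n / 2) * x) * (m⁻¹ ^ r * Real.exp (n / 4 * x)) * c ^ (-s) := by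
          gcongr
      _ = _ := by rw [e4]; ring

/-- Lower bound (A.16)–(A.22) on the marginal posterior integral. -/
theorem marginal_posterior_lower_bound (R n k a : ℝ)
    (hR0 : 0 ≤ R ^ 2) (hR : R ^ 2 < 1) (hn : 0 < n)
    (ha : 0 < a + n / 2) (h1 : 0 ≤ n - k + 2 * a) (h2 : 0 < k + 1) :
    (1 - R ^ 2) ^ (-a - n / 2) * Real.Gamma ((k + 1) / 2) *
        (n / 2 + (a + n / 2) * (1 - R ^ 2) ^ (-(1 : ℝ))) ^ (-((k + 1) / 2)) ≤
      ∫ g in Set.Ioi (0 : ℝ),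
        g ^ (-(3 : ℝ) / 2) * Real.exp (-(n / (2 * g))) *
          (g + 1) ^ (n / 2 - k / 2 + a) * (1 + g * (1 - R ^ 2)) ^ (-a - n / 2) := by
  have hc : 0 < 1 - R ^ 2 := by linarith
  generalize 1 - R ^ 2 = c at hc ⊢
  obtain ⟨s, hs⟩ : ∃ s, s = a + n / 2 := ⟨_, rfl⟩
  obtain ⟨r, hr⟩ : ∃ r, r = n / 2 - k / 2 + a := ⟨_, rfl⟩
  rw [show -a - n / 2 = -s by rw [hs]; ring, ← hs, ← hr]
  rw [← hs] at ha
  have hr0 : 0 ≤ r := by rw [hr]; linarith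
  have hq : -1 < (k - 1) / 2 := by linarith
  rw [← integral_comp_rpow_Ioi _ (show (-1 : ℝ) ≠ 0 by norm_num), rpow_neg_one]
  have key : ∀ x ∈ Set.Ioi (0 : ℝ), (|(-1 : ℝ)| * x ^ ((-1 : ℝ) - 1)) •
      ((x ^ (-1 : ℝ)) ^ (-(3 : ℝ) / 2) * Real.exp (-(n / (2 * x ^ (-1 : ℝ)))) *
          (x ^ (-1 : ℝ) + 1) ^ r * (1 + x ^ (-1 : ℝ) * c) ^ (-s)) =
      x ^ ((k - 1) / 2) * Real.exp (-(n / 2) * x) * (1 + x) ^ r * (x + c) ^ (-s) := by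
    intro x hx
    have hx : 0 < x := hx
    have f1 : x ^ (-1 : ℝ) + 1 = x ^ (-1 : ℝ) * (1 + x) := by
      rw [rpow_neg_one]; field_simp
    have f2 : 1 + x ^ (-1 : ℝ) * c = x ^ (-1 : ℝ) * (x + c) := by
      rw [rpow_neg_one]; field_simp
    have f3 : -(n / (2 * x ^ (-1 : ℝ))) = -(n / 2) * x := by
      rw [rpow_neg_one]; field_simp
    rw [f1, f2, f3, mul_rpow (by positivity) (by positivity),
      mul_rpow (by positivity) (by positivity), ← rpow_mul hx.le, ← rpow_mul hx.le,
      ← rpow_mul hx.le]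
    have f4 : x ^ ((k - 1) / 2) = x ^ ((-1 : ℝ) - 1) * x ^ (-1 * (-(3 : ℝ) / 2)) *
        x ^ (-1 * r) * x ^ (-1 * -s) := by
      rw [← rpow_add hx, ← rpow_add hx, ← rpow_add hx]
      congr 1; rw [hr, hs]; ring
    rw [f4, smul_eq_mul, abs_neg, abs_one]; ring
  rw [setIntegral_congr_fun measurableSet_Ioi key]
  have hb : 0 < n / 2 + s * c⁻¹ := by positivity
  have hG := integral_rpow_mul_exp_neg_mul_rpow (p := 1) one_pos hq hb
  have hGi := integrableOn_rpow_mul_exp_neg_mul_rpow (p := 1) hq one_pos hb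
  have hL : c ^ (-s) * Real.Gamma ((k + 1) / 2) * (n / 2 + s * c⁻¹) ^ (-((k + 1) / 2)) =
      ∫ x in Set.Ioi (0 : ℝ), c ^ (-s) *
        (x ^ ((k - 1) / 2) * Real.exp (-(n / 2 + s * c⁻¹) * x ^ (1 : ℝ))) := by
    rw [integral_const_mul, hG, show ((k - 1) / 2 + 1) / 1 = (k + 1) / 2 by ring,
      show -((k - 1) / 2 + 1) / 1 = -((k + 1) / 2) by ring]
    ring
  rw [hL]
  refine setIntegral_mono_on (hGi.const_mul _) (aux_integrable _ n r s c hq hn hr0 ha hc)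
    measurableSet_Ioi fun x hx => ?_
  have hx : 0 < x := hx
  have g1 : 1 ≤ (1 + x) ^ r := one_le_rpow (by linarith) hr0
  have g2 : c ^ (-s) * Real.exp (-(s * c⁻¹) * x) ≤ (x + c) ^ (-s) := by
    have : x + c ≤ c * Real.exp (c⁻¹ * x) := by
      have := mul_le_mul_of_nonneg_left (Real.add_one_le_exp (c⁻¹ * x)) hc.le
      rwa [mul_add, mul_inv_cancel_left₀ hc.ne', mul_one] at this
    have h := rpow_le_rpow_of_nonpos (by positivity) this (show -s ≤ 0 by linarith)
    rw [mul_rpow hc.le (by positivity), ← Real.exp_mul] at h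
    convert h using 3
    ring
  have g3 : Real.exp (-(n / 2 + s * c⁻¹) * x ^ (1 : ℝ)) =
      Real.exp (-(n / 2) * x) * Real.exp (-(s * c⁻¹) * x) := by
    rw [← Real.exp_add, rpow_one]; congr 1; ring
  calc _ = x ^ ((k - 1) / 2) * Real.exp (-(n / 2) * x) * 1 *
        (c ^ (-s) * Real.exp (-(s * c⁻¹) * x)) := by rw [g3]; ring
    _ ≤ _ := by gcongr
end

section
/- Let n, k ≥ 1 be natural numbers, y ∈ ℝⁿ, let X be a real n×k matrix with XᵀX positive definite, let g > 0, a > 0, b > 0 be reals, let H = X(XᵀX)⁻¹Xᵀ and R² = yᵀHy/(yᵀy + 2b). Then ∫₀^∞ ∫_{ℝᵏ} (2πσ²)^{−n/2} exp(−‖y − Xβ‖²/(2σ²)) · (2πgσ²)^{−k/2} (det(XᵀX))^{1/2} exp(−βᵀ(XᵀX)β/(2gσ²)) · (bᵃ/Γ(a)) (σ²)^{−(a+1)} exp(−b/σ²) dβ d(σ²) = (2π)^{−n/2} · (bᵃ Γ(a + n/2)/Γ(a)) · ((yᵀy + 2b)/2)^{−(a + n/2)} · (1 + g)^{−k/2 +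 a + n/2} · [1 + g(1 − R²)]^{−(a + n/2)}. -/
open MeasureTheory Matrix Real

lemma aux_gauss {k : ℕ} (M : Matrix (Fin k) (Fin k) ℝ) (hM : M.PosDef) (c : ℝ) (hc : 0 < c) :
    ∫ x : Fin k → ℝ, Real.exp (-c * (x ⬝ᵥ M.mulVec x)) =
      (π / c) ^ ((k : ℝ) / 2) * M.det ^ (-(1 : ℝ) / 2) := by
  obtain ⟨B, hB⟩ : ∃ B : Matrix (Fin k) (Fin k) ℝ, M = Bᵀ * B := by
    open scoped MatrixOrder Matrix.Norms.L2Operator in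
    obtain ⟨B, hB⟩ := CStarAlgebra.nonneg_iff_eq_star_mul_self.mp hM.posSemidef.nonneg
    refine ⟨B, ?_⟩
    rw [hB, Matrix.star_eq_conjTranspose, Matrix.conjTranspose_eq_transpose_of_trivial]
  have hdet : M.det = B.det ^ 2 := by rw [hB, det_mul, det_transpose, sq]
  have hpos := hM.det_pos
  have hB0 : B.det ≠ 0 := by
    intro h
    rw [hdet, h] at hpos
    simp at hpos
  have h1 : ∀ x : Fin k → ℝ, Real.exp (-c * (x ⬝ᵥ M.mulVec x)) =
      (fun z : Fin k → ℝ => ∏ i, Real.exp (-c * z i ^ 2)) (toLin' B x) := by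
    intro x
    simp only [toLin'_apply]
    rw [← Real.exp_sum, hB, ← mulVec_mulVec, dotProduct_mulVec, vecMul_transpose,
      ← Finset.mul_sum]
    simp [dotProduct, sq]
  have hemb : AEMeasurable (toLin' B) (volume : Measure (Fin k → ℝ)) :=
    (LinearMap.continuous_on_pi _).measurable.aemeasurable
  have hcont : Continuous (fun z : Fin k → ℝ => ∏ i, Real.exp (-c * z i ^ 2)) := by fun_prop
  simp_rw [h1]
  rw [← integral_map hemb hcont.aestronglyMeasurable,
    Real.map_matrix_volume_pi_eq_smul_volume_pi hB0, integral_smul_measure,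
    integral_fintype_prod_volume_eq_pow (fun x : ℝ => Real.exp (-c * x ^ 2)), integral_gaussian,
    ENNReal.toReal_ofReal (abs_nonneg _), hdet, Fintype.card_fin, smul_eq_mul, mul_comm]
  congr 1
  · rw [Real.sqrt_eq_rpow, ← Real.rpow_mul_natCast (by positivity)]
    congr 1
    ring
  · rw [neg_div, Real.rpow_neg (by positivity), ← Real.sqrt_eq_rpow, Real.sqrt_sq_eq_abs, abs_inv]

lemma aux_invgamma (c q : ℝ) (hc : 0 < c) (hq : 0 < q) :
    ∫ s in Set.Ioi (0 : ℝ), s ^ (-(c + 1)) * Real.exp (-q / s) =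
      q ^ (-c) * Real.Gamma c := by
  have h := Real.integral_rpow_mul_exp_neg_mul_Ioi hc hq
  rw [← integral_comp_rpow_Ioi _ (show (-1 : ℝ) ≠ 0 by norm_num)] at h
  rw [Real.rpow_neg hq.le, ← Real.inv_rpow hq.le, ← one_div, ← h]
  refine setIntegral_congr_fun measurableSet_Ioi (fun s hs => ?_)
  have hs : 0 < s := hs
  simp only [smul_eq_mul]
  rw [← Real.rpow_mul hs.le, ← mul_assoc, abs_neg, abs_one, one_mul, ← Real.rpow_add hs,
    Real.rpow_neg_one]
  congr 2
  · ring
  · field_simp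

/-- Marginalization (A.2)–(A.4): integrating the Gaussian likelihood times the
g-prior times the inverse-gamma prior of `σ²` over `β` and `σ²` yields the
marginal of `(𝒜, g)` up to the prior of `𝒜` and of `g`. -/
theorem marginal_likelihood_formula
    {n k : ℕ} (hn : 1 ≤ n) (hk : 1 ≤ k)
    (y : Fin n → ℝ) (X : Matrix (Fin n) (Fin k) ℝ)
    (hX : (Xᵀ * X).PosDef) (g a b : ℝ) (hg : 0 < g) (ha : 0 < a) (hb : 0 < b) :
    (∫ s in Set.Ioi (0 : ℝ), ∫ β : Fin k → ℝ,
        (2 * π * s) ^ (-(n : ℝ) / 2) *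
          Real.exp (-((y - X.mulVec β) ⬝ᵥ (y - X.mulVec β)) / (2 * s)) *
        ((2 * π * g * s) ^ (-(k : ℝ) / 2) * ((Xᵀ * X).det) ^ ((1 : ℝ) / 2) *
          Real.exp (-(β ⬝ᵥ (Xᵀ * X).mulVec β) / (2 * g * s))) *
        (b ^ a / Real.Gamma a * s ^ (-(a + 1)) * Real.exp (-b / s))) =
      (2 * π) ^ (-(n : ℝ) / 2) *
        (b ^ a * Real.Gamma (a + (n : ℝ) / 2) / Real.Gamma a) *
        ((y ⬝ᵥ y + 2 * b) / 2) ^ (-(a + (n : ℝ) / 2)) *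
        (1 + g) ^ (-(k : ℝ) / 2 + a + (n : ℝ) / 2) *
        (1 + g * (1 - (y ⬝ᵥ (X * (Xᵀ * X)⁻¹ * Xᵀ).mulVec y) / (y ⬝ᵥ y + 2 * b))) ^
          (-(a + (n : ℝ) / 2)) := by
  set v : Fin k → ℝ := Xᵀ.mulVec y with hv
  set u : Fin k → ℝ := (Xᵀ * X)⁻¹.mulVec v with hu
  have hXX : ∀ β γ : Fin k → ℝ, β ⬝ᵥ (Xᵀ * X).mulVec γ = X.mulVec β ⬝ᵥ X.mulVec γ := by
    intro β γ
    rw [← mulVec_mulVec, dotProduct_mulVec, vecMul_transpose]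
  have hMu : (Xᵀ * X).mulVec u = v := by
    rw [hu, mulVec_mulVec, Matrix.mul_nonsing_inv _ hX.det_pos.ne'.isUnit, one_mulVec]
  have hyX : ∀ β : Fin k → ℝ, X.mulVec β ⬝ᵥ y = β ⬝ᵥ v := by
    intro β
    rw [hv, dotProduct_mulVec, vecMul_transpose]
  have hXu : ∀ β : Fin k → ℝ, X.mulVec β ⬝ᵥ X.mulVec u = β ⬝ᵥ v := by
    intro β
    rw [← hXX, hMu]
  have hH : y ⬝ᵥ (X * (Xᵀ * X)⁻¹ * Xᵀ).mulVec y = u ⬝ᵥ v := by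
    rw [← mulVec_mulVec, ← mulVec_mulVec, ← hv, ← hu, dotProduct_comm, hyX]
  rw [hH]
  set t : ℝ := g / (1 + g) with ht
  have hg1 : 0 < 1 + g := by positivity
  set Q : ℝ := y ⬝ᵥ y - t * (u ⬝ᵥ v) with hQ
  have hsq : ∀ β : Fin k → ℝ, (y - X.mulVec β) ⬝ᵥ (y - X.mulVec β) +
      (β ⬝ᵥ (Xᵀ * X).mulVec β) / g =
      ((β - t • u) ⬝ᵥ (Xᵀ * X).mulVec (β - t • u)) / t + Q := by
    intro β
    have e1 : y ⬝ᵥ X.mulVec β = β ⬝ᵥ v := by rw [dotProduct_comm, hyX]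
    have e2 : X.mulVec u ⬝ᵥ X.mulVec β = β ⬝ᵥ v := by rw [dotProduct_comm, hXu]
    rw [hXX, hXX]
    simp only [mulVec_sub, mulVec_smul, sub_dotProduct, dotProduct_sub, smul_dotProduct,
      dotProduct_smul, smul_eq_mul, hyX, hXu, e1, e2, hQ, ht]
    field_simp
    ring
  have hQ0 : 0 ≤ Q := by
    have h := hsq (t • u)
    rw [sub_self, zero_dotProduct, zero_div, zero_add] at h
    rw [← h, hXX]
    have p : ∀ {m : ℕ} (w : Fin m → ℝ), 0 ≤ w ⬝ᵥ w := fun w =>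
      Finset.sum_nonneg fun i _ => mul_self_nonneg _
    have := p (y - X.mulVec (t • u))
    have := div_nonneg (p (X.mulVec (t • u))) hg.le
    linarith
  have ht0 : 0 < t := by positivity
  have hyy : 0 ≤ y ⬝ᵥ y := Finset.sum_nonneg fun i _ => mul_self_nonneg _
  have hd := hX.det_pos
  have hinner : ∀ s ∈ Set.Ioi (0 : ℝ), (∫ β : Fin k → ℝ,
        (2 * π * s) ^ (-(n : ℝ) / 2) *
          Real.exp (-((y - X.mulVec β) ⬝ᵥ (y - X.mulVec β)) / (2 * s)) *
        ((2 * π * g * s) ^ (-(k : ℝ) / 2) * ((Xᵀ * X).det) ^ ((1 : ℝ) / 2) *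
          Real.exp (-(β ⬝ᵥ (Xᵀ * X).mulVec β) / (2 * g * s))) *
        (b ^ a / Real.Gamma a * s ^ (-(a + 1)) * Real.exp (-b / s))) =
      ((2 * π) ^ (-(n : ℝ) / 2) * (1 + g) ^ (-(k : ℝ) / 2) * (b ^ a / Real.Gamma a)) *
       (s ^ (-((a + (n : ℝ) / 2) + 1)) * Real.exp (-(b + Q / 2) / s)) := by
    intro s hs
    have hs : 0 < s := hs
    have e : ∀ β : Fin k → ℝ, (2 * π * s) ^ (-(n : ℝ) / 2) *
          Real.exp (-((y - X.mulVec β) ⬝ᵥ (y - X.mulVec β)) / (2 * s)) *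
        ((2 * π * g * s) ^ (-(k : ℝ) / 2) * ((Xᵀ * X).det) ^ ((1 : ℝ) / 2) *
          Real.exp (-(β ⬝ᵥ (Xᵀ * X).mulVec β) / (2 * g * s))) *
        (b ^ a / Real.Gamma a * s ^ (-(a + 1)) * Real.exp (-b / s)) =
        ((2 * π * s) ^ (-(n : ℝ) / 2) * (2 * π * g * s) ^ (-(k : ℝ) / 2) *
          ((Xᵀ * X).det) ^ ((1 : ℝ) / 2) * (b ^ a / Real.Gamma a * s ^ (-(a + 1))) *
          Real.exp (-(b + Q / 2) / s)) *
          Real.exp (-(1 / (2 * s * t)) * ((β - t • u) ⬝ᵥ (Xᵀ * X).mulVec (β - t • u))) := by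
      intro β
      have h := hsq β
      have : Real.exp (-((y - X.mulVec β) ⬝ᵥ (y - X.mulVec β)) / (2 * s)) *
          Real.exp (-(β ⬝ᵥ (Xᵀ * X).mulVec β) / (2 * g * s)) * Real.exp (-b / s) =
          Real.exp (-(b + Q / 2) / s) *
          Real.exp (-(1 / (2 * s * t)) * ((β - t • u) ⬝ᵥ (Xᵀ * X).mulVec (β - t • u))) := by
        rw [← Real.exp_add, ← Real.exp_add, ← Real.exp_add]
        congr 1
        have h2 : (y - X.mulVec β) ⬝ᵥ (y - X.mulVec β) =
          ((β - t • u) ⬝ᵥ (Xᵀ * X).mulVec (β - t • u)) / t + Q -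
            (β ⬝ᵥ (Xᵀ * X).mulVec β) / g := by linarith
        rw [h2]
        clear_value t Q
        field_simp
        ring
      linear_combination ((2 * π * s) ^ (-(n : ℝ) / 2) * (2 * π * g * s) ^ (-(k : ℝ) / 2) *
          ((Xᵀ * X).det) ^ ((1 : ℝ) / 2) * (b ^ a / Real.Gamma a * s ^ (-(a + 1)))) * this
    simp_rw [e]
    rw [integral_const_mul,
      integral_sub_right_eq_self
        (fun β : Fin k → ℝ => Real.exp (-(1 / (2 * s * t)) * (β ⬝ᵥ (Xᵀ * X).mulVec β))) (t • u),
      aux_gauss _ hX _ (by positivity)]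
    have hdd : (Xᵀ * X).det ^ ((1 : ℝ) / 2) * (Xᵀ * X).det ^ (-(1 : ℝ) / 2) = 1 := by
      rw [← Real.rpow_add hd]
      norm_num
    have hkk : (2 * π * g * s) ^ (-(k : ℝ) / 2) * (π / (1 / (2 * s * t))) ^ ((k : ℝ) / 2) =
        (1 + g) ^ (-(k : ℝ) / 2) := by
      have : π / (1 / (2 * s * t)) = (2 * π * g * s) * (1 + g)⁻¹ := by
        rw [ht]; field_simp
      rw [this, Real.mul_rpow (x := 2 * π * g * s) (y := (1 + g)⁻¹) (by positivity) (by positivity),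
        ← mul_assoc,
        ← Real.rpow_add (by positivity), Real.inv_rpow hg1.le, ← Real.rpow_neg hg1.le]
      rw [show -(k : ℝ) / 2 + k / 2 = 0 by ring, Real.rpow_zero, one_mul, neg_div]
    have hss : (2 * π * s) ^ (-(n : ℝ) / 2) * s ^ (-(a + 1)) =
        (2 * π) ^ (-(n : ℝ) / 2) * s ^ (-((a + (n : ℝ) / 2) + 1)) := by
      rw [Real.mul_rpow (by positivity) hs.le, mul_assoc, ← Real.rpow_add hs]
      congr 2
      ring
    calc _ = ((2 * π * s) ^ (-(n : ℝ) / 2) * s ^ (-(a + 1))) *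
          ((2 * π * g * s) ^ (-(k : ℝ) / 2) * (π / (1 / (2 * s * t))) ^ ((k : ℝ) / 2)) *
          ((Xᵀ * X).det ^ ((1 : ℝ) / 2) * (Xᵀ * X).det ^ (-(1 : ℝ) / 2)) *
          (b ^ a / Real.Gamma a * Real.exp (-(b + Q / 2) / s)) := by ring
      _ = _ := by rw [hdd, hkk, hss]; ring
  rw [setIntegral_congr_fun measurableSet_Ioi hinner, integral_const_mul,
    aux_invgamma _ _ (by positivity) (by positivity)]
  have hP : 0 < (y ⬝ᵥ y + 2 * b) / 2 := by positivity
  have hbQ : b + Q / 2 = (y ⬝ᵥ y + 2 * b) / 2 *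
      ((1 + g)⁻¹ * (1 + g * (1 - (u ⬝ᵥ v) / (y ⬝ᵥ y + 2 * b)))) := by
    have : y ⬝ᵥ y + 2 * b ≠ 0 := by positivity
    rw [hQ, ht]
    field_simp
    ring
  have hbQ0 : 0 < b + Q / 2 := by positivity
  have hR : 0 < 1 + g * (1 - (u ⬝ᵥ v) / (y ⬝ᵥ y + 2 * b)) := by
    rw [hbQ] at hbQ0
    exact (pos_iff_pos_of_mul_pos ((pos_iff_pos_of_mul_pos hbQ0).1 hP)).1 (by positivity)
  rw [hbQ, Real.mul_rpow hP.le (by positivity), Real.mul_rpow (by positivity) hR.le,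
    Real.inv_rpow hg1.le, ← Real.rpow_neg hg1.le, neg_neg, add_assoc (-(k : ℝ) / 2),
    Real.rpow_add hg1 (-(k : ℝ) / 2)]
  ring
end

section
/- Let a > 0 be real, let k and k′ be positive integers with k′ > k, and for real n > 0 and R ∈ [0,1) define F(n, k, R) = ∫₀^∞ g^{−3/2} exp(−n/(2g)) (g + 1)^{n/2 − k/2 + a} [1 + g(1 − R²)]^{−a − n/2} dg. Let (Rₙ) and (R′ₙ) be sequences in [0,1) such that there exists δ > 0 with 1 − Rₙ² ≥ δ for all n, and such that there exists C > 0 with ((1 − Rₙ²)/(1 − R′ₙ²))^{n/2 + a} ≤ C for all n. Then F(n, k′, R′ₙ)/F(n, k, Rₙ) → 0 as n → ∞ (n ranging over the natural numbers). -/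
open MeasureTheory Filter Topology

/-- The (unnormalized) marginal posterior of an active set of cardinality `k`:
`F(n, k, R) = ∫₀^∞ g^{-3/2} exp(-n/(2g)) (g+1)^{n/2-k/2+a} [1+g(1-R²)]^{-a-n/2} dg`. -/
noncomputable def postF (a : ℝ) (n : ℝ) (k : ℕ) (R : ℝ) : ℝ :=
  ∫ g in Set.Ioi (0 : ℝ),
    g ^ (-(3 : ℝ) / 2) * Real.exp (-n / (2 * g)) *
      (g + 1) ^ (n / 2 - (k : ℝ) / 2 + a) * (1 + g * (1 - R ^ 2)) ^ (-a - n / 2)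

noncomputable def ff (m n κ S g : ℝ) : ℝ :=
  g ^ (-(3 : ℝ) / 2) * Real.exp (-n / (2 * g)) * (g + 1) ^ (-κ / 2) * ((g + 1) / (1 + g * S)) ^ m

noncomputable def hh (g : ℝ) : ℝ := g ^ (-(3 : ℝ) / 2) * Real.exp (-1 / (2 * g))

lemma postF_eq (a n : ℝ) (k : ℕ) (R : ℝ) (hS : 0 < 1 - R ^ 2) :
    postF a n k R = ∫ g in Set.Ioi (0 : ℝ), ff (n / 2 + a) n k (1 - R ^ 2) g := by
  unfold postF ff
  refine setIntegral_congr_fun measurableSet_Ioi ?_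
  intro g hg
  have hg : 0 < g := hg
  have h1 : 0 < 1 + g * (1 - R ^ 2) := by positivity
  have h2 : 0 < g + 1 := by positivity
  simp only
  rw [Real.div_rpow h2.le h1.le, show n / 2 - (k : ℝ) / 2 + a = -k / 2 + (n / 2 + a) by ring,
    Real.rpow_add h2, show -a - n / 2 = -(n / 2 + a) by ring, Real.rpow_neg h1.le]
  ring

lemma ff_nonneg (m n κ S g : ℝ) (hg : 0 < g) (hS : 0 < S) : 0 ≤ ff m n κ S g := by
  unfold ff
  have : 0 < 1 + g * S := by positivity
  positivity

lemma hh_int : IntegrableOn hh (Set.Ioi 0) := by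
  have hm : Measurable hh := by unfold hh; fun_prop
  rw [← Set.Ioc_union_Ioi_eq_Ioi (zero_le_one : (0:ℝ) ≤ 1)]
  refine IntegrableOn.union ?_ ?_
  · have hb : IntegrableOn (fun _ : ℝ => (8:ℝ)) (Set.Ioc 0 1) := by simp
    refine Integrable.mono' hb hm.aestronglyMeasurable ?_
    filter_upwards [ae_restrict_mem measurableSet_Ioc] with g hg
    have hg0 : 0 < g := hg.1
    have hg1 : g ≤ 1 := hg.2
    have h0 : 0 ≤ hh g := by unfold hh; positivity
    rw [Real.norm_of_nonneg h0]
    unfold hh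
    have he : Real.exp (-1 / (2 * g)) ≤ 8 * g ^ 2 := by
      have := Real.quadratic_le_exp_of_nonneg (x := 1 / (2 * g)) (by positivity)
      rw [show -1 / (2 * g) = -(1 / (2 * g)) by ring, Real.exp_neg]
      have h2 : (8 * g ^ 2)⁻¹ ≤ Real.exp (1 / (2 * g)) := by
        refine le_trans ?_ this
        have : (8 * g ^ 2)⁻¹ = (1 / (2 * g)) ^ 2 / 2 := by field_simp; norm_num
        rw [this]
        have : 0 < 1 / (2 * g) := by positivity
        linarith
      exact inv_le_of_inv_le₀ (by positivity) h2
    calc g ^ (-(3 : ℝ) / 2) * Real.exp (-1 / (2 * g)) ≤ g ^ (-(3 : ℝ) / 2) * (8 * g ^ 2) := by gcongr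
      _ = 8 * g ^ ((1:ℝ)/2) := by
        rw [show (1:ℝ)/2 = -3/2 + 2 by norm_num, Real.rpow_add hg0, Real.rpow_two]; ring
      _ ≤ 8 * 1 := by
        gcongr
        exact Real.rpow_le_one hg0.le hg1 (by norm_num)
      _ = 8 := by norm_num
  · have hb : IntegrableOn (fun t : ℝ => t ^ (-(3:ℝ)/2)) (Set.Ioi 1) :=
      integrableOn_Ioi_rpow_of_lt (by norm_num) one_pos
    refine Integrable.mono' hb hm.aestronglyMeasurable ?_
    filter_upwards [ae_restrict_mem measurableSet_Ioi] with g hg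
    have hg0 : 0 < g := lt_trans one_pos hg
    have h0 : 0 ≤ hh g := by unfold hh; positivity
    rw [Real.norm_of_nonneg h0]
    unfold hh
    have : Real.exp (-1 / (2 * g)) ≤ 1 := by
      rw [Real.exp_le_one_iff]
      exact div_nonpos_of_nonpos_of_nonneg (by norm_num) (by positivity)
    exact mul_le_of_le_one_right (by positivity) this

lemma phi_mono {S x y : ℝ} (hS : 0 < S) (hS1 : S ≤ 1) (hx : 0 < x) (hxy : x ≤ y) :
    (x + 1) / (1 + x * S) ≤ (y + 1) / (1 + y * S) := by
  have hy : 0 < y := by linarith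
  rw [div_le_div_iff₀ (by positivity) (by positivity)]
  nlinarith [mul_nonneg (sub_nonneg.2 hxy) (sub_nonneg.2 hS1)]

lemma exp_bd {n g M : ℝ} (hn : 1 ≤ n) (hg : 0 < g) (hgM : g ≤ M) :
    Real.exp (-n / (2 * g)) ≤ Real.exp (-(n - 1) / (2 * M)) * Real.exp (-1 / (2 * g)) := by
  rw [← Real.exp_add, Real.exp_le_exp]
  have h : (n - 1) / (2 * M) ≤ (n - 1) / (2 * g) := by
    have : 0 ≤ n - 1 := by linarith
    gcongr
  have e1 : -n / (2 * g) = -((n - 1) / (2 * g)) + -1 / (2 * g) := by ring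
  have e2 : -(n - 1) / (2 * M) = -((n - 1) / (2 * M)) := by ring
  rw [e1, e2]; linarith

lemma ff_le {m n κ S g M : ℝ} (hm : 0 ≤ m) (hn : 1 ≤ n) (hκ : 0 ≤ κ) (hS : 0 < S) (hS1 : S ≤ 1)
    (hg : 0 < g) (hgM : g ≤ M) :
    ff m n κ S g ≤ ((M + 1) / (1 + M * S)) ^ m * Real.exp (-(n - 1) / (2 * M)) * hh g := by
  have hM : 0 < M := by linarith
  unfold ff hh
  have h1 := exp_bd hn hg hgM
  have h2 : (g + 1) ^ (-κ / 2) ≤ 1 :=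
    Real.rpow_le_one_of_one_le_of_nonpos (by linarith) (by linarith)
  have h3 : ((g + 1) / (1 + g * S)) ^ m ≤ ((M + 1) / (1 + M * S)) ^ m := by
    have := phi_mono hS hS1 hg hgM
    gcongr
  calc _ ≤ g ^ (-(3 : ℝ) / 2) * (Real.exp (-(n - 1) / (2 * M)) * Real.exp (-1 / (2 * g))) * 1
        * ((M + 1) / (1 + M * S)) ^ m := by gcongr
    _ = _ := by ring

lemma ff_int {m n κ S : ℝ} (hm : 0 ≤ m) (hn : 1 ≤ n) (hκ : 0 ≤ κ) (hS : 0 < S) :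
    IntegrableOn (ff m n κ S) (Set.Ioi 0) := by
  have hmeas : Measurable (ff m n κ S) := by unfold ff; fun_prop
  refine Integrable.mono' (hh_int.const_mul ((max 1 (1/S)) ^ m)) hmeas.aestronglyMeasurable ?_
  filter_upwards [ae_restrict_mem measurableSet_Ioi] with g hg
  have hg : 0 < g := hg
  rw [Real.norm_of_nonneg (ff_nonneg m n κ S g hg hS)]
  unfold ff hh
  have h1 : Real.exp (-n / (2 * g)) ≤ Real.exp (-1 / (2 * g)) := by
    gcongr
  have h2 : (g + 1) ^ (-κ / 2) ≤ 1 :=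
    Real.rpow_le_one_of_one_le_of_nonpos (by linarith) (by linarith)
  have h3 : ((g + 1) / (1 + g * S)) ^ m ≤ (max 1 (1/S)) ^ m := by
    have : (g + 1) / (1 + g * S) ≤ max 1 (1/S) := by
      rw [div_le_iff₀ (by positivity)]
      have a1 := le_max_left 1 (1/S)
      have a2 := le_max_right 1 (1/S)
      have a3 : 1 ≤ max 1 (1/S) * S := by
        rwa [div_le_iff₀ hS] at a2
      nlinarith
    gcongr
  calc _ ≤ g ^ (-(3 : ℝ) / 2) * Real.exp (-1 / (2 * g)) * 1 * (max 1 (1/S)) ^ m := by gcongr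
    _ = _ := by ring

/-- Lower bound. -/
lemma ff_lower {m n κ S M : ℝ} (hm : 0 ≤ m) (hn : 1 ≤ n) (hκ : 0 ≤ κ) (hS : 0 < S) (hS1 : S ≤ 1)
    (hM : 0 < M) :
    ((M + 1) / (1 + M * S)) ^ m * Real.exp (-n / (4 * M)) *
      (M * ((3 * M) ^ (-(3 : ℝ) / 2) * (3 * M + 1) ^ (-κ / 2))) ≤
      ∫ g in Set.Ioi (0 : ℝ), ff m n κ S g := by
  have hint := ff_int hm hn hκ hS
  have hsub : Set.Ioc (2 * M) (3 * M) ⊆ Set.Ioi 0 := fun x hx => by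
    have := hx.1
    simp only [Set.mem_Ioi]; linarith
  set c := ((M + 1) / (1 + M * S)) ^ m * Real.exp (-n / (4 * M)) *
      ((3 * M) ^ (-(3 : ℝ) / 2) * (3 * M + 1) ^ (-κ / 2)) with hc
  have h1 : ∫ g in Set.Ioc (2 * M) (3 * M), ff m n κ S g ≤ ∫ g in Set.Ioi (0 : ℝ), ff m n κ S g := by
    refine setIntegral_mono_set hint ?_ hsub.eventuallyLE
    filter_upwards [ae_restrict_mem measurableSet_Ioi] with g hg
    exact ff_nonneg m n κ S g hg hS
  have h2 : ∫ g in Set.Ioc (2 * M) (3 * M), c ≤ ∫ g in Set.Ioc (2 * M) (3 * M), ff m n κ S g := by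
    refine setIntegral_mono_on (by simp) (hint.mono_set hsub) measurableSet_Ioc ?_
    intro g hg
    have g1 : 2 * M < g := hg.1
    have g2 : g ≤ 3 * M := hg.2
    have hg0 : 0 < g := by linarith
    unfold ff
    have e1 : (3 * M) ^ (-(3 : ℝ) / 2) ≤ g ^ (-(3 : ℝ) / 2) :=
      Real.rpow_le_rpow_of_nonpos hg0 g2 (by norm_num)
    have e2 : (3 * M + 1) ^ (-κ / 2) ≤ (g + 1) ^ (-κ / 2) :=
      Real.rpow_le_rpow_of_nonpos (by linarith) (by linarith) (by linarith)
    have e3 : Real.exp (-n / (4 * M)) ≤ Real.exp (-n / (2 * g)) := by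
      rw [Real.exp_le_exp, neg_div, neg_div, neg_le_neg_iff]
      have : 4 * M ≤ 2 * g := by linarith
      gcongr
    have e4 : ((M + 1) / (1 + M * S)) ^ m ≤ ((g + 1) / (1 + g * S)) ^ m := by
      have := phi_mono hS hS1 hM (by linarith : M ≤ g)
      gcongr
    calc c = (3 * M) ^ (-(3 : ℝ) / 2) * Real.exp (-n / (4 * M)) * (3 * M + 1) ^ (-κ / 2) *
          ((M + 1) / (1 + M * S)) ^ m := by rw [hc]; ring
      _ ≤ _ := by gcongr
  have h3 : ∫ g in Set.Ioc (2 * M) (3 * M), c = M * c := by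
    rw [setIntegral_const, Measure.real, Real.volume_Ioc, ENNReal.toReal_ofReal (by linarith)]
    simp only [smul_eq_mul]; ring
  calc _ = M * c := by rw [hc]; ring
    _ ≤ _ := by rw [← h3]; exact h2.trans h1

lemma ff_compare {m n κ κ' S S' C g : ℝ} (hm : 0 ≤ m) (hκ : κ + 1 ≤ κ')
    (hS : 0 < S) (hS' : 0 < S') (hC : (S / S') ^ m ≤ C) (hg : 0 < g) :
    ff m n κ' S' g ≤ max 1 C * ((g + 1) ^ (-(1:ℝ) / 2) * ff m n κ S g) := by
  unfold ff
  have e1 : (g + 1) ^ (-κ' / 2) ≤ (g + 1) ^ (-(1:ℝ) / 2) * (g + 1) ^ (-κ / 2) := by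
    rw [← Real.rpow_add (by linarith)]
    exact Real.rpow_le_rpow_of_exponent_le (by linarith) (by linarith)
  have e2 : ((g + 1) / (1 + g * S')) ^ m ≤ max 1 C * ((g + 1) / (1 + g * S)) ^ m := by
    rcases le_total S S' with h | h
    · calc _ ≤ 1 * ((g + 1) / (1 + g * S)) ^ m := by rw [one_mul]; gcongr
        _ ≤ _ := by gcongr; exact le_max_left _ _
    · calc _ ≤ (S / S' * ((g + 1) / (1 + g * S))) ^ m := by
            gcongr
            rw [div_mul_div_comm, div_le_div_iff₀ (by positivity) (by positivity)]
            have : S' * (1 + g * S) ≤ S * (1 + g * S') := by nlinarith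
            nlinarith
        _ = (S / S') ^ m * ((g + 1) / (1 + g * S)) ^ m := by
            rw [Real.mul_rpow (by positivity) (by positivity)]
        _ ≤ _ := by gcongr; exact hC.trans (le_max_right _ _)
  calc _ ≤ g ^ (-(3 : ℝ) / 2) * Real.exp (-n / (2 * g)) *
        ((g + 1) ^ (-(1:ℝ) / 2) * (g + 1) ^ (-κ / 2)) *
        (max 1 C * ((g + 1) / (1 + g * S)) ^ m) := by gcongr
    _ = _ := by ring

lemma ratio_bd {m n κ κ' S S' C M : ℝ} (hm : 0 ≤ m) (hn : 1 ≤ n) (hκ0 : 0 ≤ κ) (hκ : κ + 1 ≤ κ')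
    (hS : 0 < S) (hS1 : S ≤ 1) (hS' : 0 < S') (hC : (S / S') ^ m ≤ C) (hM : 0 < M) :
    (∫ g in Set.Ioi (0 : ℝ), ff m n κ' S' g) / (∫ g in Set.Ioi (0 : ℝ), ff m n κ S g) ≤
      max 1 C * ((M + 1) ^ (-(1:ℝ) / 2) +
        Real.exp (-(n - 2) / (4 * M)) * ((∫ g in Set.Ioi (0 : ℝ), hh g) /
          (M * ((3 * M) ^ (-(3 : ℝ) / 2) * (3 * M + 1) ^ (-κ / 2))))) := by
  set c := M * ((3 * M) ^ (-(3 : ℝ) / 2) * (3 * M + 1) ^ (-κ / 2)) with hc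
  have hc0 : 0 < c := by positivity
  set H := ∫ g in Set.Ioi (0 : ℝ), hh g with hH
  have hH0 : 0 ≤ H := setIntegral_nonneg measurableSet_Ioi (fun g hg => by
    have hg : 0 < g := hg
    unfold hh; positivity)
  have hlow := ff_lower hm hn hκ0 hS hS1 hM
  rw [← hc] at hlow
  set F := ∫ g in Set.Ioi (0 : ℝ), ff m n κ S g with hF
  set P := ((M + 1) / (1 + M * S)) ^ m with hP
  have hP0 : 0 < P := by positivity
  have hF0 : 0 < F := lt_of_lt_of_le (by positivity) hlow
  have hup : ∫ g in Set.Ioi (0 : ℝ), ff m n κ' S' g ≤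
      max 1 C * ((M + 1) ^ (-(1:ℝ) / 2) * F + P * Real.exp (-(n - 1) / (2 * M)) * H) := by
    have i1 := ff_int hm hn hκ0 hS
    have i2 := (i1.const_mul ((M + 1) ^ (-(1:ℝ) / 2)))
    have i3 := hh_int.const_mul (P * Real.exp (-(n - 1) / (2 * M)))
    rw [hF, hH, ← integral_const_mul, ← integral_const_mul, ← integral_add i2 i3,
      ← integral_const_mul]
    refine setIntegral_mono_on (ff_int hm hn (by linarith) hS') ((i2.add i3).const_mul _)
      measurableSet_Ioi ?_
    intro g hg
    have hg : 0 < g := hg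
    refine (ff_compare hm hκ hS hS' hC hg).trans ?_
    have hf0 := ff_nonneg m n κ S g hg hS
    have hh0 : 0 ≤ hh g := by unfold hh; positivity
    refine mul_le_mul_of_nonneg_left ?_ (le_trans zero_le_one (le_max_left _ _))
    rcases le_total g M with h | h
    · have := ff_le hm hn hκ0 hS hS1 hg h
      rw [← hP] at this
      have h2 : (g + 1) ^ (-(1:ℝ) / 2) ≤ 1 :=
        Real.rpow_le_one_of_one_le_of_nonpos (by linarith) (by norm_num)
      have h3 : 0 ≤ (M + 1) ^ (-(1:ℝ) / 2) * ff m n κ S g := by positivity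
      have h4 := mul_le_of_le_one_left hf0 h2
      linarith
    · have h2 : (g + 1) ^ (-(1:ℝ) / 2) ≤ (M + 1) ^ (-(1:ℝ) / 2) :=
        Real.rpow_le_rpow_of_nonpos (by linarith) (by linarith) (by norm_num)
      have h3 : 0 ≤ P * Real.exp (-(n - 1) / (2 * M)) * hh g := by positivity
      have h4 := mul_le_mul_of_nonneg_right h2 hf0
      linarith
  rw [div_le_iff₀ hF0]
  refine hup.trans ?_
  rw [mul_assoc (max 1 C) _ F]
  refine mul_le_mul_of_nonneg_left ?_ (le_trans zero_le_one (le_max_left _ _))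
  rw [add_mul]
  refine add_le_add le_rfl ?_
  calc P * Real.exp (-(n - 1) / (2 * M)) * H
      = Real.exp (-(n - 2) / (4 * M)) * (H / c) * (P * Real.exp (-n / (4 * M)) * c) := by
        have : Real.exp (-(n - 1) / (2 * M)) =
            Real.exp (-(n - 2) / (4 * M)) * Real.exp (-n / (4 * M)) := by
          rw [← Real.exp_add]; congr 1; field_simp; ring
        rw [this]; field_simp
    _ ≤ _ := by gcongr

theorem posterior_ratio_tendsto_zero_nested
    (a : ℝ) (ha : 0 < a) (k k' : ℕ) (hk : 0 < k) (hk' : 0 < k') (hkk : k < k')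
    (R R' : ℕ → ℝ)
    (hR : ∀ n, 0 ≤ R n ∧ R n < 1) (hR' : ∀ n, 0 ≤ R' n ∧ R' n < 1)
    (hδ : ∃ δ : ℝ, 0 < δ ∧ ∀ n, δ ≤ 1 - R n ^ 2)
    (hC : ∃ C : ℝ, 0 < C ∧ ∀ n : ℕ,
      ((1 - R n ^ 2) / (1 - R' n ^ 2)) ^ ((n : ℝ) / 2 + a) ≤ C) :
    Tendsto (fun n : ℕ => postF a n k' (R' n) / postF a n k (R n)) atTop (𝓝 0) := by
  obtain ⟨C, hC0, hC⟩ := hC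
  have hS : ∀ n, 0 < 1 - R n ^ 2 := fun n => by nlinarith [hR n]
  have hS' : ∀ n, 0 < 1 - R' n ^ 2 := fun n => by nlinarith [hR' n]
  have hD : 0 < max 1 C := lt_of_lt_of_le one_pos (le_max_left _ _)
  have hnn : ∀ n : ℕ, 0 ≤ postF a n k' (R' n) / postF a n k (R n) := fun n => by
    rw [postF_eq _ _ _ _ (hS n), postF_eq _ _ _ _ (hS' n)]
    exact div_nonneg
      (setIntegral_nonneg measurableSet_Ioi fun g hg => ff_nonneg _ _ _ _ g hg (hS' n))
      (setIntegral_nonneg measurableSet_Ioi fun g hg => ff_nonneg _ _ _ _ g hg (hS n))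
  refine tendsto_order.2 ⟨fun b hb => Eventually.of_forall fun n => lt_of_lt_of_le hb (hnn n), ?_⟩
  intro ε hε
  have hMlim : Tendsto (fun M : ℝ => (M + 1) ^ (-(1:ℝ) / 2)) atTop (𝓝 0) := by
    have := (tendsto_rpow_neg_atTop (y := (1:ℝ)/2) (by norm_num)).comp
      (tendsto_atTop_add_const_right atTop (1:ℝ) tendsto_id)
    refine this.congr fun M => ?_
    simp only [Function.comp, id]
    norm_num
  have hev := (hMlim.eventually (gt_mem_nhds (show 0 < ε / (2 * max 1 C) by positivity))).and
    (eventually_gt_atTop 0)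
  obtain ⟨M, hM1, hM⟩ := hev.exists
  set B := (∫ g in Set.Ioi (0 : ℝ), hh g) /
          (M * ((3 * M) ^ (-(3 : ℝ) / 2) * (3 * M + 1) ^ (-(k:ℝ) / 2))) with hB
  have hElim : Tendsto (fun n : ℕ => Real.exp (-((n:ℝ) - 2) / (4 * M)) * B) atTop (𝓝 0) := by
    rw [show (0:ℝ) = 0 * B by ring]
    refine Tendsto.mul_const B (Real.tendsto_exp_atBot.comp ?_)
    refine Tendsto.atBot_div_const (by positivity) ?_
    refine tendsto_neg_atTop_atBot.comp ?_
    exact tendsto_atTop_add_const_right atTop (-2:ℝ) tendsto_natCast_atTop_atTop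
  filter_upwards [hElim.eventually (gt_mem_nhds (show 0 < ε / (2 * max 1 C) by positivity)),
    eventually_ge_atTop 1] with n hn1 hn
  rw [postF_eq _ _ _ _ (hS n), postF_eq _ _ _ _ (hS' n)]
  have hn' : (1:ℝ) ≤ n := by exact_mod_cast hn
  have hkk' : (k:ℝ) + 1 ≤ k' := by exact_mod_cast hkk
  refine lt_of_le_of_lt (ratio_bd (M := M) (by positivity) hn' (Nat.cast_nonneg k) hkk' (hS n)
    (by nlinarith [sq_nonneg (R n)]) (hS' n) (hC n) hM) ?_
  rw [← hB]
  calc _ < max 1 C * (ε / (2 * max 1 C) + ε / (2 * max 1 C)) := by gcongr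
    _ = ε := by field_simp; norm_num
end
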